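/- Let g ∈ S₀(ℝⁿ). Then for any 0 < s < t ≤ ∞, g*(s) − g*(t) ≤ (1/ln 2) ∫_{s/2}^{t} [g*(u) − g*(2u)] du/u (where g*(∞) is interpreted as 0 when t = ∞). -/

import Mathlib

open MeasureTheory Set
open scoped ENNReal

noncomputable section

/-- Extended essential sup norm on ℝ. -/
def einf (φ : ℝ → ℝ) : ℝ≥0∞ := eLpNorm φ ⊤ volume

/-- Lipschitz `α` seminorm (extended real valued):
`sup_{h>0} h^{-α} ‖φ(·+h) - φ‖_∞`. -/
def lipSemiE (α : ℝ) (φ : ℝ → ℝ) : ℝ≥0∞ :=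
  ⨆ h ∈ Ioi (0:ℝ), ENNReal.ofReal (h ^ (-α)) * einf (fun x => φ (x + h) - φ x)

/-- Real-valued Lipschitz `α` seminorm `‖φ‖*_{Lip α}`. -/
def lipSemi (α : ℝ) (φ : ℝ → ℝ) : ℝ := (lipSemiE α φ).toReal

/-- `φ ∈ Lip α`: essentially bounded with finite Lipschitz `α` seminorm. -/
def MemLip (α : ℝ) (φ : ℝ → ℝ) : Prop := einf φ < ⊤ ∧ lipSemiE α φ < ⊤

/-- `‖φ‖_{Lip α} = ‖φ‖_∞ + ‖φ‖*_{Lip α}`. -/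
def lipNorm (α : ℝ) (φ : ℝ → ℝ) : ℝ := (einf φ + lipSemiE α φ).toReal

/-- The class `S₀`: measurable functions with finite distribution function at every
positive level. -/
def S0 {X : Type*} [MeasureSpace X] (f : X → ℝ) : Prop :=
  Measurable f ∧ ∀ s : ℝ, 0 < s → volume {x | s < |f x|} < ⊤

/-- The non-increasing rearrangement `f*`. -/
def rearr {X : Type*} [MeasureSpace X] (f : X → ℝ) (t : ℝ) : ℝ :=
  sInf {s : ℝ | 0 ≤ s ∧ volume {x | s < |f x|} ≤ ENNReal.ofReal t}

/-- `f**(t) = (1/t) ∫₀^t f*(u) du`. -/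
def doubleStar {X : Type*} [MeasureSpace X] (f : X → ℝ) (t : ℝ) : ℝ :=
  (∫ u in Ioc (0:ℝ) t, rearr f u) / t

/-- Lorentz `L^{p,q}` norm. -/
def lorentzNorm {X : Type*} [MeasureSpace X] (p q : ℝ) (f : X → ℝ) : ℝ :=
  (∫ t in Ioi (0:ℝ), (t ^ (1/p) * rearr f t) ^ q / t) ^ (1/q)

/-- Membership in the Lorentz space `L^{p,q}`. -/
def MemLorentz {X : Type*} [MeasureSpace X] (p q : ℝ) (f : X → ℝ) : Prop :=
  S0 f ∧ IntegrableOn (fun t => (t ^ (1/p) * rearr f t) ^ q / t) (Ioi (0:ℝ))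

/-- The space `U_p(ℝ²)`: a.e. sections in `Lip (1/p)`, with `Lip (1/p)` norms of the
sections in `L^{p,1}(ℝ)`. -/
def MemUp (p : ℝ) (f : ℝ × ℝ → ℝ) : Prop :=
  Measurable f ∧
  (∀ᵐ y : ℝ ∂volume, MemLip (1/p) (fun x => f (x, y))) ∧
  (∀ᵐ x : ℝ ∂volume, MemLip (1/p) (fun y => f (x, y))) ∧
  MemLorentz p 1 (fun y => lipNorm (1/p) (fun x => f (x, y))) ∧
  MemLorentz p 1 (fun x => lipNorm (1/p) (fun y => f (x, y)))

/-- The Steklov-type average `f_h`. -/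
def avg (f : ℝ × ℝ → ℝ) (h : ℝ) (z : ℝ × ℝ) : ℝ :=
  (∫ u in Ioc (0:ℝ) h, ∫ v in Ioc (0:ℝ) h, f (z.1 + u, z.2 + v)) / h ^ 2

section Antitone

variable {f : ℝ → ℝ}

theorem AntitoneOn.intervalIntegrable_mul_inv (hf : AntitoneOn f (Ioi 0)) {a b : ℝ}
    (ha : 0 < a) (hb : 0 < b) : IntervalIntegrable (fun u => f u * u⁻¹) volume a b := by
  have hsub : uIcc a b ⊆ Ioi 0 := fun x hx => lt_of_lt_of_le (lt_min ha hb) hx.1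
  exact (hf.mono hsub).intervalIntegrable.mul_continuousOn
    (continuousOn_id.inv₀ fun x hx => (hsub hx).ne')

theorem integral_inv_two_mul {a : ℝ} (ha : 0 < a) (c : ℝ) :
    ∫ u in a..2 * a, c * u⁻¹ = c * Real.log 2 := by
  rw [intervalIntegral.integral_const_mul, integral_inv_of_pos ha (by positivity),
    mul_div_cancel_right₀ _ ha.ne']

theorem intervalIntegrable_const_mul_inv {a : ℝ} (ha : 0 < a) (c : ℝ) :
    IntervalIntegrable (fun u => c * u⁻¹) volume a (2 * a) :=
  AntitoneOn.intervalIntegrable_mul_inv (f := fun _ => c) antitoneOn_const ha (by positivity)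

theorem AntitoneOn.mul_log_two_le_integral (hf : AntitoneOn f (Ioi 0)) {a : ℝ} (ha : 0 < a) :
    f (2 * a) * Real.log 2 ≤ ∫ u in a..2 * a, f u * u⁻¹ := by
  rw [← integral_inv_two_mul ha]
  refine intervalIntegral.integral_mono_on (by linarith) (intervalIntegrable_const_mul_inv ha _)
    (hf.intervalIntegrable_mul_inv ha (by positivity)) fun u hu => ?_
  have hu0 : 0 < u := ha.trans_le hu.1
  exact mul_le_mul_of_nonneg_right (hf hu0 (hu0.trans_le hu.2) hu.2) (by positivity)

theorem AntitoneOn.integral_le_mul_log_two (hf : AntitoneOn f (Ioi 0)) {a : ℝ} (ha : 0 < a) :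
    ∫ u in a..2 * a, f u * u⁻¹ ≤ f a * Real.log 2 := by
  rw [← integral_inv_two_mul ha]
  refine intervalIntegral.integral_mono_on (by linarith)
    (hf.intervalIntegrable_mul_inv ha (by positivity)) (intervalIntegrable_const_mul_inv ha _)
    fun u hu => ?_
  have hu0 : 0 < u := ha.trans_le hu.1
  exact mul_le_mul_of_nonneg_right (hf ha hu0 hu.1) (by positivity)

theorem AntitoneOn.intervalIntegrable_comp_two_mul_mul_inv (hf : AntitoneOn f (Ioi 0)) {a b : ℝ}
    (ha : 0 < a) (hb : 0 < b) :
    IntervalIntegrable (fun u => f (2 * u) * u⁻¹) volume a b :=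
  AntitoneOn.intervalIntegrable_mul_inv (f := fun u => f (2 * u))
    (fun _ hx _ hy hxy => hf (mem_Ioi.2 (mul_pos two_pos hx)) (mem_Ioi.2 (mul_pos two_pos hy))
      (mul_le_mul_of_nonneg_left hxy two_pos.le)) ha hb

theorem AntitoneOn.sub_mul_log_two_le_integral (hf : AntitoneOn f (Ioi 0)) {a b : ℝ}
    (ha : 0 < a) (hb : 0 < b) :
    (f (2 * a) - f b) * Real.log 2 ≤ ∫ u in a..b, (f u - f (2 * u)) / u := by
  have hint : ∀ {x y : ℝ}, 0 < x → 0 < y →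
      IntervalIntegrable (fun u => f u * u⁻¹) volume x y :=
    fun hx hy => hf.intervalIntegrable_mul_inv hx hy
  have ha2 : 0 < 2 * a := by positivity
  have hb2 : 0 < 2 * b := by positivity
  have hscale : ∫ u in a..b, f (2 * u) * u⁻¹ = ∫ u in 2 * a..2 * b, f u * u⁻¹ := by
    have h := intervalIntegral.mul_integral_comp_mul_left (a := a) (b := b) (c := 2)
      (f := fun u => f u * u⁻¹)
    rw [← h, ← intervalIntegral.integral_const_mul]
    congr 1 with u
    rw [mul_inv]
    ring
  have hsplit : ∫ u in a..b, (f u - f (2 * u)) / u =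
      (∫ u in a..b, f u * u⁻¹) - ∫ u in 2 * a..2 * b, f u * u⁻¹ := by
    rw [← hscale, ← intervalIntegral.integral_sub (hint ha hb)
      (hf.intervalIntegrable_comp_two_mul_mul_inv ha hb)]
    congr 1 with u
    rw [div_eq_mul_inv, sub_mul]
  have h₁ := intervalIntegral.integral_add_adjacent_intervals (hint ha ha2) (hint ha2 hb2)
  have h₂ := intervalIntegral.integral_add_adjacent_intervals (hint ha hb) (hint hb hb2)
  have h₃ := hf.mul_log_two_le_integral ha
  have h₄ := hf.integral_le_mul_log_two hb
  rw [hsplit]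
  linarith

theorem AntitoneOn.ofReal_sub_le_lintegral (hf : AntitoneOn f (Ioi 0)) {s t : ℝ}
    (hs : 0 < s) (hst : s < t) :
    ENNReal.ofReal (f s - f t) ≤ ENNReal.ofReal (1 / Real.log 2) *
      ∫⁻ u in Ioc (s / 2) t, ENNReal.ofReal ((f u - f (2 * u)) / u) := by
  have ha : 0 < s / 2 := by positivity
  have ht : 0 < t := hs.trans hst
  have hle : s / 2 ≤ t := by linarith
  have hlog : 0 < Real.log 2 := Real.log_pos one_lt_two
  have hint : IntegrableOn (fun u => (f u - f (2 * u)) / u) (Ioc (s / 2) t) := by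
    rw [← intervalIntegrable_iff_integrableOn_Ioc_of_le hle]
    simpa only [div_eq_mul_inv, sub_mul] using (hf.intervalIntegrable_mul_inv ha ht).sub
      (hf.intervalIntegrable_comp_two_mul_mul_inv ha ht)
  have hnonneg : 0 ≤ᵐ[volume.restrict (Ioc (s / 2) t)] fun u => (f u - f (2 * u)) / u := by
    filter_upwards [ae_restrict_mem measurableSet_Ioc] with u hu
    have hu0 : 0 < u := ha.trans hu.1
    exact div_nonneg (sub_nonneg.2 (hf hu0 (mul_pos two_pos hu0) (by linarith))) hu0.le
  rw [← ofReal_integral_eq_lintegral_ofReal hint hnonneg, ← ENNReal.ofReal_mul (by positivity),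
    ← intervalIntegral.integral_of_le hle]
  refine ENNReal.ofReal_le_ofReal ?_
  have h := hf.sub_mul_log_two_le_integral ha ht
  rw [mul_div_cancel₀ s two_ne_zero] at h
  rwa [one_div, inv_mul_eq_div, le_div_iff₀ hlog]

end Antitone

section Rearrangement

variable {X : Type*} [MeasureSpace X] {f : X → ℝ}

theorem bddBelow_rearr_levels (f : X → ℝ) (t : ℝ) :
    BddBelow {s : ℝ | 0 ≤ s ∧ volume {x | s < |f x|} ≤ ENNReal.ofReal t} :=
  ⟨0, fun _ hs => hs.1⟩

theorem rearr_nonneg (f : X → ℝ) (t : ℝ) : 0 ≤ rearr f t :=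
  Real.sInf_nonneg fun _ hs => hs.1

theorem S0.tendsto_volume_lt_abs (hf : S0 f) :
    Filter.Tendsto (fun k : ℕ => volume {x | (k : ℝ) + 1 < |f x|}) Filter.atTop (nhds 0) := by
  have hempty : ⋂ k : ℕ, {x | (k : ℝ) + 1 < |f x|} = ∅ := by
    refine eq_empty_of_forall_notMem fun x hx => ?_
    obtain ⟨k, hk⟩ := exists_nat_ge |f x|
    have := mem_iInter.1 hx k
    simp only [mem_ofPred_eq] at this
    linarith
  rw [← measure_empty (μ := (volume : Measure X)), ← hempty]
  refine tendsto_measure_iInter_atTop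
    (fun k => (measurableSet_lt measurable_const hf.1.abs).nullMeasurableSet) ?_
    ⟨0, (hf.2 _ (by positivity)).ne⟩
  intro i j hij x hx
  have hij' : (i : ℝ) ≤ j := Nat.cast_le.2 hij
  simp only [mem_ofPred_eq] at hx ⊢
  linarith

theorem S0.rearr_levels_nonempty (hf : S0 f) {t : ℝ} (ht : 0 < t) :
    {s : ℝ | 0 ≤ s ∧ volume {x | s < |f x|} ≤ ENNReal.ofReal t}.Nonempty := by
  obtain ⟨k, hk⟩ := (hf.tendsto_volume_lt_abs.eventually_le_const (ENNReal.ofReal_pos.2 ht)).exists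
  exact ⟨k + 1, by positivity, hk⟩

theorem S0.antitoneOn_rearr (hf : S0 f) : AntitoneOn (rearr f) (Ioi 0) := fun _ hs t _ hst =>
  csInf_le_csInf (bddBelow_rearr_levels f t) (hf.rearr_levels_nonempty hs)
    fun _ hy => ⟨hy.1, hy.2.trans (ENNReal.ofReal_le_ofReal hst)⟩

theorem S0.tendsto_rearr_atTop (hf : S0 f) :
    Filter.Tendsto (rearr f) Filter.atTop (nhds 0) := by
  refine tendsto_order.2 ⟨fun a ha => .of_forall fun t => ha.trans_le (rearr_nonneg f t),
    fun ε hε => ?_⟩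
  filter_upwards [Filter.eventually_ge_atTop (volume {x | ε / 2 < |f x|}).toReal] with t ht
  refine (csInf_le (bddBelow_rearr_levels f t) ⟨(half_pos hε).le, ?_⟩).trans_lt (half_lt_self hε)
  exact (ENNReal.le_ofReal_iff_toReal_le (hf.2 _ (half_pos hε)).ne
    (ENNReal.toReal_nonneg.trans ht)).2 ht

end Rearrangement

/-- For `g ∈ S₀(ℝⁿ)` and `0 < s < t ≤ ∞`,
`g*(s) - g*(t) ≤ (1/ln 2) ∫_{s/2}^t [g*(u) - g*(2u)] du/u`
(with `g*(∞) = 0` when `t = ∞`). -/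
theorem stmt3 (n : ℕ) (g : (Fin n → ℝ) → ℝ) (hg : S0 g) :
    (∀ s t : ℝ, 0 < s → s < t →
      ENNReal.ofReal (rearr g s - rearr g t) ≤
        ENNReal.ofReal (1 / Real.log 2) *
          ∫⁻ u in Ioc (s/2) t, ENNReal.ofReal ((rearr g u - rearr g (2*u)) / u)) ∧
    (∀ s : ℝ, 0 < s →
      ENNReal.ofReal (rearr g s) ≤
        ENNReal.ofReal (1 / Real.log 2) *
          ∫⁻ u in Ioi (s/2), ENNReal.ofReal ((rearr g u - rearr g (2*u)) / u)) := by
  refine ⟨fun s t hs hst => hg.antitoneOn_rearr.ofReal_sub_le_lintegral hs hst, fun s hs => ?_⟩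
  have hlim : Filter.Tendsto (fun t => ENNReal.ofReal (rearr g s - rearr g t)) Filter.atTop
      (nhds (ENNReal.ofReal (rearr g s))) := by
    have h := tendsto_const_nhds (x := rearr g s) |>.sub hg.tendsto_rearr_atTop
    rw [sub_zero] at h
    exact ENNReal.tendsto_ofReal h
  refine le_of_tendsto hlim ?_
  filter_upwards [Filter.eventually_gt_atTop s] with t hst
  exact (hg.antitoneOn_rearr.ofReal_sub_le_lintegral hs hst).trans
    (mul_le_mul_right (lintegral_mono_set Ioc_subset_Ioi_self) _)

end
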